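/- In the descent algebra ΣD_4 of the Coxeter group D_4, the following identity holds: B_{[4]} · B_{[1,3]} = 2 B_{[1,3]} + B_{[1,2,1]} + B_{[1,1,2]}, where [4] is taken in C_4 and [1,3], [1,2,1], [1,1,2] are taken in C_1. -/

import Mathlib

open scoped Classical

namespace DescentD

/-- The domain on which the Coxeter group `D_n` acts: the pair `(k, b)` encodes the
integer `k + 1` if `b = true` and `-(k + 1)` if `b = false`.  (We use `Fin (n + 1)`
so that the type is always nonempty; only the points with `k < n` are moved.) -/
abbrev Dom (n : ℕ) := Fin (n + 1) × Bool

/-- The point of `Dom n` encoding the nonzero integer `a` (for `1 ≤ |a| ≤ n`). -/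
def pt (n : ℕ) (a : ℤ) : Dom n :=
  (⟨(a.natAbs - 1) % (n + 1), Nat.mod_lt _ n.succ_pos⟩, decide (0 < a))

/-- The transposition exchanging the points encoding `a` and `b`. -/
def swapD (n : ℕ) (a b : ℤ) : Equiv.Perm (Dom n) := Equiv.swap (pt n a) (pt n b)

/-- The Coxeter generators of `D_n`:  index `0` is `s_{1'} = (-2,1)(-1,2)` and index
`i` with `1 ≤ i ≤ n - 1` is `s_i = (-i-1,-i)(i,i+1)`. -/
def gen (n : ℕ) (i : ℕ) : Equiv.Perm (Dom n) :=
  if i = 0 then swapD n (-2) 1 * swapD n (-1) 2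
  else swapD n (-(i : ℤ) - 1) (-(i : ℤ)) * swapD n (i : ℤ) ((i : ℤ) + 1)

/-- The Coxeter group `D_n`, as the subgroup generated by `s_{1'}, s_1, …, s_{n-1}`. -/
def Dgroup (n : ℕ) : Subgroup (Equiv.Perm (Dom n)) :=
  Subgroup.closure (gen n '' Set.Iio n)

/-- Coxeter length of `w` with respect to the generators of `D_n`. -/
noncomputable def len (n : ℕ) (w : Equiv.Perm (Dom n)) : ℕ :=
  sInf {k | ∃ l : List ℕ, (∀ i ∈ l, i < n) ∧ l.length = k ∧ (l.map (gen n)).prod = w}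

/-- The parabolic subgroup `W_J` for a set `J` of generator indices. -/
def WJ (n : ℕ) (J : Set ℕ) : Subgroup (Equiv.Perm (Dom n)) :=
  Subgroup.closure (gen n '' J)

/-- The set `X_J` of minimal length left coset representatives of `W_J` in `D_n`. -/
def X (n : ℕ) (J : Set ℕ) : Set (Equiv.Perm (Dom n)) :=
  {w | w ∈ Dgroup n ∧ ∀ u ∈ WJ n J, len n w ≤ len n (w * u)}

/-- `𝒳_J`: the sum, in the group algebra `ℚ[D_n]`, of the minimal length left coset
representatives of `W_J`. -/
noncomputable def XX (n : ℕ) (J : Set ℕ) : MonoidAlgebra ℚ (Equiv.Perm (Dom n)) :=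
  ∑ w : Equiv.Perm (Dom n),
    if w ∈ X n J then MonoidAlgebra.of ℚ (Equiv.Perm (Dom n)) w else 0

/-- `q` is a composition of `m`: a list of positive integers with sum `m`. -/
def IsComposition (q : List ℕ) (m : ℕ) : Prop := (∀ x ∈ q, 0 < x) ∧ q.sum = m

/-- The four families making up `C(n)`:  `C_{<n}`, `C_1`, `C_n` and `C_n'`. -/
inductive Kind | lt | one | reg | prime
deriving DecidableEq

/-- Membership of a composition in each of the four families of `C(n)`. -/
def memC (n : ℕ) : Kind → List ℕ → Prop
  | .lt, q => (∀ x ∈ q, 0 < x) ∧ q.sum + 2 ≤ n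
  | .one, q => (∀ x ∈ q, 0 < x) ∧ q.sum = n ∧ q.headD 0 = 1
  | .reg, q => (∀ x ∈ q, 0 < x) ∧ q.sum = n ∧ 2 ≤ q.headD 0
  | .prime, q => (∀ x ∈ q, 0 < x) ∧ q.sum = n ∧ 2 ≤ q.headD 0

/-- The sum of the first `j` components of `q`. -/
def psum (q : List ℕ) (j : ℕ) : ℕ := (q.take j).sum

/-- The subset of generator indices (`0` standing for `s_{1'}`, `i ≥ 1` for `s_i`)
corresponding to `q ∈ C(n)`. -/
def JofC (n : ℕ) : Kind → List ℕ → Set ℕ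
  | .lt, q => {s | ∃ j < q.length, s = (n - q.sum) + psum q j}
  | .one, q => {0} ∪ {s | ∃ j, 1 ≤ j ∧ j < q.length ∧ s = psum q j}
  | .reg, q => {0} ∪ {s | ∃ j, 1 ≤ j ∧ j < q.length ∧ s = psum q j}
  | .prime, q => {1} ∪ {s | ∃ j, 1 ≤ j ∧ j < q.length ∧ s = psum q j}

/-- The basis element `B_q = 𝒳_{J^c}` of `ΣD_n`, for `q` in the family `k` of `C(n)`. -/
noncomputable def B (n : ℕ) (k : Kind) (q : List ℕ) :
    MonoidAlgebra ℚ (Equiv.Perm (Dom n)) :=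
  XX n (Set.Iio n \ JofC n k q)

/-- Coding of the points of `Dom 4` by natural numbers, for which negation is `x ↦ 10 - x`
and the order is that of the encoded integers. -/
def code (x : Dom 4) : ℕ := bif x.2 then 6 + x.1.val else 4 - x.1.val

theorem code_injective : Function.Injective code := by
  unfold Function.Injective; decide

/-- Codes of the images of `1, 2, 3, 4`. -/
abbrev Window := ℕ × ℕ × ℕ × ℕ

def window (w : Equiv.Perm (Dom 4)) : Window :=
  (code (w (0, true)), code (w (1, true)), code (w (2, true)), code (w (3, true)))

/-- The effect on windows of right multiplication by a generator. -/
def actRight : ℕ → Window → Window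
  | 0, (x, y, z, t) => (10 - y, 10 - x, z, t)
  | 1, (x, y, z, t) => (y, x, z, t)
  | 2, (x, y, z, t) => (x, z, y, t)
  | _, (x, y, z, t) => (x, y, t, z)

/-- The effect on codes of applying a generator. -/
def actCode (s x : ℕ) : ℕ :=
  match s with
  | 0 => bif x.beq 6 then 3 else bif x.beq 7 then 4 else bif x.beq 3 then 6 else
      bif x.beq 4 then 7 else x
  | s + 1 => bif x.beq (6 + s) then 7 + s else bif x.beq (7 + s) then 6 + s else
      bif x.beq (4 - s) then 3 - s else bif x.beq (3 - s) then 4 - s else x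

/-- The effect on windows of left multiplication by a generator. -/
def actLeft (s : ℕ) : Window → Window
  | (x, y, z, t) => (actCode s x, actCode s y, actCode s z, actCode s t)

/-- The indicator, as a number, of `y < x`. -/
def gtCount (x y : ℕ) : ℕ := bif y.blt x then 1 else 0

/-- The number of pairs `i < j` with `w i + w j < 0`. -/
def negPairs : Window → ℕ
  | (x, y, z, t) => gtCount 10 (x + y) + gtCount 10 (x + z) + gtCount 10 (x + t) +
      gtCount 10 (y + z) + gtCount 10 (y + t) + gtCount 10 (z + t)

/-- The number of pairs `1 < j` with `w 1 > w j`. -/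
def invFirst : Window → ℕ
  | (x, y, z, t) => gtCount x y + gtCount x z + gtCount x t

/-- The combinatorial length of a window. -/
def wlen : Window → ℕ
  | (x, y, z, t) => negPairs (x, y, z, t) + invFirst (x, y, z, t) +
      gtCount y z + gtCount y t + gtCount z t

/-- The absolute value of a code. -/
def absCode (x : ℕ) : ℕ := bif x.blt 5 then 5 - x else x - 5

/-- Windows of the elements of `D_4`: four codes with distinct absolute values in
`{1, 2, 3, 4}`, an even number of which are negative. -/
def isWindow : Window → Bool
  | (x, y, z, t) =>
    let a := absCode x; let b := absCode y; let c := absCode z; let d := absCode t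
    (Nat.blt 0 a && Nat.blt a 5) && ((Nat.blt 0 b && Nat.blt b 5 && !(a.beq b)) &&
    ((Nat.blt 0 c && Nat.blt c 5 && !(a.beq c) && !(b.beq c)) &&
    ((Nat.blt 0 d && Nat.blt d 5 && !(a.beq d) && !(b.beq d) && !(c.beq d)) &&
    ((gtCount 5 x + gtCount 5 y + gtCount 5 z + gtCount 5 t) % 2).beq 0)))

/-- Exhaustive check of a Boolean property of windows. -/
def checkAll (p : Window → Bool) : Bool :=
  (List.range 10).all fun x => (List.range 10).all fun y => absCode x == absCode y ||
    (List.range 10).all fun z => absCode x == absCode z || absCode y == absCode z ||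
      (List.range 10).all fun t => !isWindow (x, y, z, t) || p (x, y, z, t)

theorem lt_of_absCode_lt {x : ℕ} (h : absCode x < 5) : x < 10 := by
  unfold absCode at h
  cases hx : x.blt 5 <;> simp [hx] at h <;> simp [Nat.blt] at hx <;> omega

theorem of_checkAll {p : Window → Bool} (h : checkAll p = true) :
    ∀ v, isWindow v = true → p v = true := by
  rintro ⟨x, y, z, t⟩ hv
  have hv' := hv
  simp only [isWindow, Bool.and_eq_true, Nat.blt_eq, Bool.not_eq_true',
    ← Bool.not_eq_true, Nat.beq_eq] at hv'
  obtain ⟨hx, ⟨hy, hxy⟩, ⟨⟨hz, hxz⟩, hyz⟩, ⟨⟨⟨ht, -⟩, -⟩, -⟩, -⟩ := hv'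
  simp only [checkAll, List.all_eq_true, List.mem_range, Bool.or_eq_true, beq_iff_eq] at h
  have h1 := (h x (lt_of_absCode_lt hx.2) y (lt_of_absCode_lt hy.2)).resolve_left hxy
  have h2 := (h1 z (lt_of_absCode_lt hz.2)).resolve_left (by simp [hxz, hyz])
  simpa [hv] using h2 t (lt_of_absCode_lt ht.2)

/-- Having no descent at a generator in `J`. -/
def isMin (J : List ℕ) (v : Window) : Bool := J.all fun j => (wlen v).blt (wlen (actRight j v))

theorem isWindow_actRight : ∀ v, isWindow v = true →
    ([0, 1, 2, 3].all fun s => isWindow (actRight s v)) = true :=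
  of_checkAll (by decide +kernel)

theorem wlen_actRight : ∀ v, isWindow v = true →
    ([0, 1, 2, 3].all fun s => Nat.beq (wlen (actRight s v)) (wlen v + 1) ||
      Nat.beq (wlen (actRight s v) + 1) (wlen v)) = true :=
  of_checkAll (by decide +kernel)

theorem exists_descent : ∀ v, isWindow v = true →
    ((v == (6, 7, 8, 9)) ||
      [0, 1, 2, 3].any fun s => Nat.beq (wlen (actRight s v) + 1) (wlen v)) = true :=
  of_checkAll (by decide +kernel)

/-- Reduced words of the minimal coset representatives for `{s_1, s_2, s_3}`. -/
def spinWords : List (List ℕ) :=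
  [[], [0], [2, 0], [1, 2, 0], [3, 2, 0], [1, 3, 2, 0], [2, 1, 3, 2, 0], [0, 2, 1, 3, 2, 0]]

def wordWindow (l : List ℕ) : Window := l.foldl (fun v s => actRight s v) (6, 7, 8, 9)

theorem exists_spinWord : ∀ v, isWindow v = true →
    (!isMin [1, 2, 3] v || spinWords.any fun l => wordWindow l == v) = true :=
  of_checkAll (by decide +kernel)

def indicator (b : Bool) : ℕ := bif b then 1 else 0

theorem count_spinWords : ∀ v, isWindow v = true →
    ((spinWords.map fun l =>
        indicator (isMin [2, 3] (l.foldl (fun v s => actLeft s v) v))).sum ==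
      2 * indicator (isMin [2, 3] v) + indicator (isMin [2] v) + indicator (isMin [3] v)) = true :=
  of_checkAll (by decide +kernel)

theorem cast_count_spinWords {v : Window} (hv : isWindow v = true) :
    (spinWords.map fun l =>
        (indicator (isMin [2, 3] (l.foldl (fun v s => actLeft s v) v)) : ℚ)).sum =
      2 * (indicator (isMin [2, 3] v) : ℚ) + (indicator (isMin [2] v) : ℚ) +
        (indicator (isMin [3] v) : ℚ) := by
  have h := congrArg (Nat.cast : ℕ → ℚ) (beq_iff_eq.1 (count_spinWords v hv))
  rw [Nat.cast_list_sum, List.map_map] at h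
  push_cast at h
  exact h

/-- The statistic `M` is constant on cosets of `W_J`, bounds the length from below, and is
equal to the length on windows without descents in `J`. -/
def isMinLength (J : List ℕ) (M : Window → ℕ) (v : Window) : Bool :=
  (J.all fun j => Nat.beq (M (actRight j v)) (M v)) && Nat.ble (M v) (wlen v) &&
    (!isMin J v || Nat.ble (wlen v) (M v))

theorem isMinLength_negPairs : ∀ v, isWindow v = true → isMinLength [1, 2, 3] negPairs v = true :=
  of_checkAll (by decide +kernel)

theorem isMinLength_negPairs_add_invFirst : ∀ v, isWindow v = true →
    isMinLength [2, 3] (fun v => negPairs v + invFirst v) v = true :=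
  of_checkAll (by decide +kernel)

theorem isMinLength_sub_two : ∀ v, isWindow v = true →
    isMinLength [2] (fun v => wlen v - gtCount v.2.1 v.2.2.1) v = true :=
  of_checkAll (by decide +kernel)

theorem isMinLength_sub_three : ∀ v, isWindow v = true →
    isMinLength [3] (fun v => wlen v - gtCount v.2.2.1 v.2.2.2) v = true :=
  of_checkAll (by decide +kernel)

/-- Signed permutations of `Dom 4` fixing the points with `k = 4`. -/
def signedPerms : Subgroup (Equiv.Perm (Dom 4)) where
  carrier := {w | (∀ k b, w (k, !b) = ((w (k, b)).1, !(w (k, b)).2)) ∧ ∀ b, w (4, b) = (4, b)}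
  one_mem' := by simp
  mul_mem' := by
    rintro a b ⟨ha, ha'⟩ ⟨hb, hb'⟩
    refine ⟨fun k c => ?_, fun c => by simp [ha', hb']⟩
    simp only [Equiv.Perm.mul_apply, hb]
    rw [ha]
  inv_mem' := by
    rintro a ⟨ha, ha'⟩
    refine ⟨fun k c => ?_, fun c => ?_⟩
    · rw [Equiv.Perm.inv_eq_iff_eq, ha]
      simp
    · rw [Equiv.Perm.inv_eq_iff_eq, ha']

theorem gen_mem_signedPerms : ∀ s < 4, gen 4 s ∈ signedPerms := by
  have : ∀ s < 4, (∀ k b, gen 4 s (k, !b) = ((gen 4 s (k, b)).1, !(gen 4 s (k, b)).2)) ∧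
      ∀ b, gen 4 s (4, b) = (4, b) := by decide +kernel
  exact this

theorem Dgroup_le_signedPerms : Dgroup 4 ≤ signedPerms := by
  rw [Dgroup, Subgroup.closure_le]
  rintro _ ⟨s, hs, rfl⟩
  exact gen_mem_signedPerms s hs

theorem gen_mem_Dgroup {s : ℕ} (hs : s < 4) : gen 4 s ∈ Dgroup 4 :=
  Subgroup.subset_closure ⟨s, hs, rfl⟩

theorem gen_mul_gen : ∀ s < 4, gen 4 s * gen 4 s = 1 := by
  have : ∀ s < 4, ∀ x, gen 4 s (gen 4 s x) = x := by decide +kernel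
  exact fun s hs => Equiv.ext (this s hs)

theorem gen_inv {s : ℕ} (hs : s < 4) : (gen 4 s)⁻¹ = gen 4 s :=
  inv_eq_of_mul_eq_one_left (gen_mul_gen s hs)

theorem code_neg (x : Dom 4) : code (x.1, !x.2) = 10 - code x := by
  revert x; decide

theorem code_gen : ∀ s < 4, ∀ x, code (gen 4 s x) = bif x.1 == 4 then code x else
    actCode s (code x) := by
  decide +kernel

theorem window_injOn : Set.InjOn window signedPerms := by
  rintro a ⟨ha, ha'⟩ b ⟨hb, hb'⟩ h
  simp only [window, Prod.mk.injEq, code_injective.eq_iff] at h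
  obtain ⟨h0, h1, h2, h3⟩ := h
  have key : ∀ k, a (k, true) = b (k, true) := by
    intro k
    fin_cases k
    · exact h0
    · exact h1
    · exact h2
    · exact h3
    · exact (ha' true).trans (hb' true).symm
  ext1 ⟨k, c⟩
  cases c
  · have h1 := ha k true
    have h2 := hb k true
    rw [key k] at h1
    exact h1.trans h2.symm
  · exact key k

theorem window_one : window 1 = (6, 7, 8, 9) := rfl

theorem gen_apply : gen 4 0 (0, true) = (1, !true) ∧ gen 4 0 (1, true) = (0, !true) ∧
    gen 4 0 (2, true) = (2, true) ∧ gen 4 0 (3, true) = (3, true) ∧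
    gen 4 1 (0, true) = (1, true) ∧ gen 4 1 (1, true) = (0, true) ∧
    gen 4 1 (2, true) = (2, true) ∧ gen 4 1 (3, true) = (3, true) ∧
    gen 4 2 (0, true) = (0, true) ∧ gen 4 2 (1, true) = (2, true) ∧
    gen 4 2 (2, true) = (1, true) ∧ gen 4 2 (3, true) = (3, true) ∧
    gen 4 3 (0, true) = (0, true) ∧ gen 4 3 (1, true) = (1, true) ∧
    gen 4 3 (2, true) = (3, true) ∧ gen 4 3 (3, true) = (2, true) := by
  decide +kernel

theorem window_mul_gen {w : Equiv.Perm (Dom 4)} (hw : w ∈ signedPerms) {s : ℕ} (hs : s < 4) :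
    window (w * gen 4 s) = actRight s (window w) := by
  have hneg : ∀ k, code (w (k, !true)) = 10 - code (w (k, true)) := fun k => by
    rw [hw.1, code_neg]
  have hg := gen_apply
  interval_cases s <;> simp only [window, Equiv.Perm.mul_apply, hg, hneg, actRight]

theorem window_gen_mul {w : Equiv.Perm (Dom 4)} (hw : w ∈ signedPerms) {s : ℕ} (hs : s < 4) :
    window (gen 4 s * w) = actLeft s (window w) := by
  have h : ∀ k : Fin 5, k ≠ 4 → code (gen 4 s (w (k, true))) = actCode s (code (w (k, true))) := by
    intro k hk
    have h4 : (w (k, true)).1 ≠ 4 := by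
      intro h
      have : w (k, true) = w (4, (w (k, true)).2) := by
        rw [hw.2, ← h]
      exact hk (congrArg Prod.fst (w.injective this))
    rw [code_gen s hs, beq_eq_false_iff_ne.2 h4, cond_false]
  simp [window, actLeft, h]

theorem mem_generators {s : ℕ} (hs : s < 4) : s ∈ [0, 1, 2, 3] := by
  interval_cases s <;> simp

theorem isWindow_window {w : Equiv.Perm (Dom 4)} (hw : w ∈ Dgroup 4) :
    isWindow (window w) = true := by
  induction hw using Subgroup.closure_induction_right with
  | one => decide
  | mul_right x hx y hy ih =>
    obtain ⟨s, hs, rfl⟩ := hy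
    rw [window_mul_gen (Dgroup_le_signedPerms hx) hs]
    exact List.all_eq_true.1 (isWindow_actRight _ ih) s (mem_generators hs)
  | mul_inv_cancel x hx y hy ih =>
    obtain ⟨s, hs, rfl⟩ := hy
    rw [gen_inv hs, window_mul_gen (Dgroup_le_signedPerms hx) hs]
    exact List.all_eq_true.1 (isWindow_actRight _ ih) s (mem_generators hs)

/-- The element of `D_4` represented by a word in the generators. -/
def wordProd (l : List ℕ) : Equiv.Perm (Dom 4) := (l.map (gen 4)).prod

theorem wordProd_mem {l : List ℕ} (hl : ∀ i ∈ l, i < 4) : wordProd l ∈ Dgroup 4 :=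
  Subgroup.list_prod_mem _ (by simpa using fun i hi => gen_mem_Dgroup (hl i hi))

theorem window_mul_wordProd {l : List ℕ} (hl : ∀ i ∈ l, i < 4) {w : Equiv.Perm (Dom 4)}
    (hw : w ∈ Dgroup 4) :
    window (w * wordProd l) = l.foldl (fun v s => actRight s v) (window w) := by
  induction l generalizing w with
  | nil => simp [wordProd]
  | cons s l ih =>
    have hs := hl s (by simp)
    rw [List.foldl_cons, ← window_mul_gen (Dgroup_le_signedPerms hw) hs,
      ← ih (fun i hi => hl i (by simp [hi])) (mul_mem hw (gen_mem_Dgroup hs))]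
    simp [wordProd, mul_assoc]

theorem window_wordProd {l : List ℕ} (hl : ∀ i ∈ l, i < 4) :
    window (wordProd l) = wordWindow l := by
  rw [← one_mul (wordProd l), window_mul_wordProd hl (one_mem _), window_one, wordWindow]

theorem window_wordProd_inv_mul {l : List ℕ} (hl : ∀ i ∈ l, i < 4) {w : Equiv.Perm (Dom 4)}
    (hw : w ∈ Dgroup 4) :
    window ((wordProd l)⁻¹ * w) = l.foldl (fun v s => actLeft s v) (window w) := by
  induction l generalizing w with
  | nil => simp [wordProd]
  | cons s l ih =>
    have hs := hl s (by simp)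
    rw [List.foldl_cons, ← window_gen_mul (Dgroup_le_signedPerms hw) hs,
      ← ih (fun i hi => hl i (by simp [hi])) (mul_mem (gen_mem_Dgroup hs) hw)]
    simp [wordProd, mul_assoc, gen_inv hs]

theorem wlen_mul_gen {w : Equiv.Perm (Dom 4)} (hw : w ∈ Dgroup 4) {s : ℕ} (hs : s < 4) :
    wlen (actRight s (window w)) = wlen (window w) + 1 ∨
      wlen (actRight s (window w)) + 1 = wlen (window w) := by
  simpa using List.all_eq_true.1 (wlen_actRight _ (isWindow_window hw)) s (mem_generators hs)

theorem wlen_wordProd_le {l : List ℕ} (hl : ∀ i ∈ l, i < 4) :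
    wlen (window (wordProd l)) ≤ l.length := by
  induction l using List.reverseRecOn with
  | nil => simp [wordProd, window_one]; decide
  | append_singleton l s ih =>
    have hs := hl s (by simp)
    have hl' : ∀ i ∈ l, i < 4 := fun i hi => hl i (by simp [hi])
    have hw := wordProd_mem hl'
    have : wordProd (l ++ [s]) = wordProd l * gen 4 s := by simp [wordProd]
    rw [this, window_mul_gen (Dgroup_le_signedPerms hw) hs, List.length_append,
      List.length_singleton]
    have := ih hl'
    have := wlen_mul_gen hw hs
    omega

theorem exists_word (k : ℕ) {w : Equiv.Perm (Dom 4)} (hw : w ∈ Dgroup 4)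
    (hk : wlen (window w) = k) : ∃ l : List ℕ, (∀ i ∈ l, i < 4) ∧ l.length = k ∧ wordProd l = w := by
  induction k generalizing w with
  | zero =>
    have h := exists_descent _ (isWindow_window hw)
    simp only [hk, Bool.or_eq_true, beq_iff_eq, List.any_eq_true, Nat.beq_eq] at h
    rcases h with h | ⟨s, -, h⟩
    · refine ⟨[], by simp, rfl, ?_⟩
      exact window_injOn (one_mem _) (Dgroup_le_signedPerms hw) (window_one.trans h.symm)
    · omega
  | succ k ih =>
    have h := exists_descent _ (isWindow_window hw)
    simp only [Bool.or_eq_true, beq_iff_eq, List.any_eq_true, Nat.beq_eq] at h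
    rcases h with h | ⟨s, hs, h⟩
    · rw [h] at hk
      exact absurd hk.symm (Nat.succ_ne_zero k)
    · have hs : s < 4 := by
        simp only [List.mem_cons, List.not_mem_nil, or_false] at hs
        omega
      obtain ⟨l, hl, hlen, hprod⟩ := ih (mul_mem hw (gen_mem_Dgroup hs))
        (by rw [window_mul_gen (Dgroup_le_signedPerms hw) hs]; omega)
      refine ⟨l ++ [s], ?_, by simp [hlen], ?_⟩
      · intro i hi
        rcases List.mem_append.1 hi with hi | hi
        · exact hl i hi
        · simp only [List.mem_singleton] at hi
          omega
      · have : wordProd (l ++ [s]) = wordProd l * gen 4 s := by simp [wordProd]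
        rw [this, hprod, mul_assoc, gen_mul_gen s hs, mul_one]

theorem len_eq_wlen {w : Equiv.Perm (Dom 4)} (hw : w ∈ Dgroup 4) : len 4 w = wlen (window w) := by
  refine IsLeast.csInf_eq ⟨exists_word _ hw rfl, ?_⟩
  rintro k ⟨l, hl, rfl, rfl⟩
  exact wlen_wordProd_le hl

theorem WJ_le_Dgroup {J : List ℕ} (hJ : ∀ j ∈ J, j < 4) : WJ 4 {j | j ∈ J} ≤ Dgroup 4 :=
  Subgroup.closure_mono (Set.image_mono fun j hj => hJ j hj)

theorem mem_X_iff {J : List ℕ} (hJ : ∀ j ∈ J, j < 4) {M : Window → ℕ}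
    (hM : ∀ v, isWindow v = true → isMinLength J M v = true) (w : Equiv.Perm (Dom 4)) :
    w ∈ X 4 {j | j ∈ J} ↔ w ∈ Dgroup 4 ∧ isMin J (window w) = true := by
  refine and_congr_right fun hw => ⟨fun h => ?_, fun h u hu => ?_⟩
  · refine List.all_eq_true.2 fun j hj => ?_
    have h1 := h (gen 4 j) (Subgroup.subset_closure ⟨j, hj, rfl⟩)
    rw [len_eq_wlen hw, len_eq_wlen (mul_mem hw (gen_mem_Dgroup (hJ j hj))),
      window_mul_gen (Dgroup_le_signedPerms hw) (hJ j hj)] at h1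
    have := wlen_mul_gen hw (hJ j hj)
    rw [Nat.blt_eq]
    omega
  · simp only [isMinLength, Bool.and_eq_true, List.all_eq_true, Nat.beq_eq, Nat.ble_eq,
      Bool.or_eq_true, Bool.not_eq_true'] at hM
    have hD : ∀ u ∈ WJ 4 {j | j ∈ J}, w * u ∈ Dgroup 4 :=
      fun u hu => mul_mem hw (WJ_le_Dgroup hJ hu)
    have hconst : M (window (w * u)) = M (window w) := by
      induction hu using Subgroup.closure_induction_right with
      | one => simp
      | mul_right x hx y hy ih =>
        obtain ⟨s, hs, rfl⟩ := hy
        rw [← mul_assoc, window_mul_gen (Dgroup_le_signedPerms (hD x hx)) (hJ s hs),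
          (hM _ (isWindow_window (hD x hx))).1.1 s hs, ih]
      | mul_inv_cancel x hx y hy ih =>
        obtain ⟨s, hs, rfl⟩ := hy
        rw [gen_inv (hJ s hs), ← mul_assoc,
          window_mul_gen (Dgroup_le_signedPerms (hD x hx)) (hJ s hs),
          (hM _ (isWindow_window (hD x hx))).1.1 s hs, ih]
    rw [len_eq_wlen hw, len_eq_wlen (hD u hu)]
    have h1 := (hM _ (isWindow_window hw)).2.resolve_left (by simp [h])
    have h2 := (hM _ (isWindow_window (hD u hu))).1.2
    omega

theorem spinWords_lt : ∀ l ∈ spinWords, ∀ i ∈ l, i < 4 := by decide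

theorem spinWords_isMin : ∀ l ∈ spinWords, isMin [1, 2, 3] (wordWindow l) = true := by decide

theorem nodup_spinWords : (spinWords.map wordWindow).Nodup := by decide +kernel

theorem nodup_wordProd : (spinWords.map wordProd).Nodup := by
  refine List.Nodup.of_map window ?_
  rw [List.map_map]
  convert nodup_spinWords using 1
  exact List.map_congr_left fun l hl => window_wordProd (spinWords_lt l hl)

theorem filter_X_eq :
    Finset.univ.filter (· ∈ X 4 {j | j ∈ [1, 2, 3]}) = (spinWords.map wordProd).toFinset := by
  ext w
  rw [Finset.mem_filter_univ, mem_X_iff (by decide) isMinLength_negPairs, List.mem_toFinset,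
    List.mem_map]
  constructor
  · rintro ⟨hw, h⟩
    have := exists_spinWord _ (isWindow_window hw)
    simp only [h, Bool.not_true, Bool.false_or, List.any_eq_true, beq_iff_eq] at this
    obtain ⟨l, hl, hlw⟩ := this
    refine ⟨l, hl, window_injOn (Dgroup_le_signedPerms (wordProd_mem (spinWords_lt l hl)))
      (Dgroup_le_signedPerms hw) ?_⟩
    rw [window_wordProd (spinWords_lt l hl), hlw]
  · rintro ⟨l, hl, rfl⟩
    refine ⟨wordProd_mem (spinWords_lt l hl), ?_⟩
    rw [window_wordProd (spinWords_lt l hl)]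
    exact spinWords_isMin l hl

theorem XX_apply (n : ℕ) (J : Set ℕ) (g : Equiv.Perm (Dom n)) :
    (XX n J).coeff g = if g ∈ X n J then 1 else 0 := by
  rw [XX, MonoidAlgebra.coeff_sum, Finset.sum_apply', Finset.sum_eq_single g]
  · split_ifs <;> simp
  · intro w _ hw
    split_ifs <;> simp [hw]
  · simp

theorem XX_mul_apply (f : MonoidAlgebra ℚ (Equiv.Perm (Dom 4))) (g : Equiv.Perm (Dom 4)) :
    (XX 4 {j | j ∈ [1, 2, 3]} * f).coeff g =
      (spinWords.map fun l => f.coeff ((wordProd l)⁻¹ * g)).sum := by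
  rw [XX, ← Finset.sum_filter, filter_X_eq, Finset.sum_mul, MonoidAlgebra.coeff_sum,
    Finset.sum_apply', List.sum_toFinset _ nodup_wordProd, List.map_map]
  simp [Function.comp_def, MonoidAlgebra.of_apply, MonoidAlgebra.coeff_single_mul_apply]

theorem XX_apply_of_mem {J : List ℕ} (hJ : ∀ j ∈ J, j < 4) {M : Window → ℕ}
    (hM : ∀ v, isWindow v = true → isMinLength J M v = true) {w : Equiv.Perm (Dom 4)}
    (hw : w ∈ Dgroup 4) :
    (XX 4 {j | j ∈ J}).coeff w = (indicator (isMin J (window w)) : ℚ) := by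
  rw [XX_apply, mem_X_iff hJ hM]
  cases h : isMin J (window w) <;> simp [hw, indicator]

theorem XX_apply_of_notMem (J : Set ℕ) {w : Equiv.Perm (Dom 4)} (hw : w ∉ Dgroup 4) :
    (XX 4 J).coeff w = 0 := by
  rw [XX_apply, if_neg fun h => hw h.1]

theorem XX_two_three_apply {g : Equiv.Perm (Dom 4)} (hg : g ∈ Dgroup 4) :
    (XX 4 {j | j ∈ [2, 3]}).coeff g = (indicator (isMin [2, 3] (window g)) : ℚ) :=
  XX_apply_of_mem (by decide) isMinLength_negPairs_add_invFirst hg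

theorem XX_two_apply {g : Equiv.Perm (Dom 4)} (hg : g ∈ Dgroup 4) :
    (XX 4 {j | j ∈ [2]}).coeff g = (indicator (isMin [2] (window g)) : ℚ) :=
  XX_apply_of_mem (by decide) isMinLength_sub_two hg

theorem XX_three_apply {g : Equiv.Perm (Dom 4)} (hg : g ∈ Dgroup 4) :
    (XX 4 {j | j ∈ [3]}).coeff g = (indicator (isMin [3] (window g)) : ℚ) :=
  XX_apply_of_mem (by decide) isMinLength_sub_three hg

theorem XX_two_three_apply_wordProd_inv_mul {l : List ℕ} (hl : ∀ i ∈ l, i < 4)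
    {g : Equiv.Perm (Dom 4)} (hg : g ∈ Dgroup 4) :
    (XX 4 {j | j ∈ [2, 3]}).coeff ((wordProd l)⁻¹ * g) =
      (indicator (isMin [2, 3] (l.foldl (fun v s => actLeft s v) (window g))) : ℚ) := by
  have h : (wordProd l)⁻¹ * g ∈ Dgroup 4 :=
    (Dgroup 4).mul_mem ((Dgroup 4).inv_mem (wordProd_mem hl)) hg
  rw [XX_two_three_apply h]
  exact congrArg (fun v => (indicator (isMin [2, 3] v) : ℚ)) (window_wordProd_inv_mul hl hg)

theorem sum_XX_apply_of_mem {g : Equiv.Perm (Dom 4)} (hg : g ∈ Dgroup 4) :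
    (spinWords.map fun l => (XX 4 {j | j ∈ [2, 3]}).coeff ((wordProd l)⁻¹ * g)).sum =
      2 * (XX 4 {j | j ∈ [2, 3]}).coeff g + (XX 4 {j | j ∈ [2]}).coeff g +
        (XX 4 {j | j ∈ [3]}).coeff g := by
  rw [XX_two_three_apply hg, XX_two_apply hg, XX_three_apply hg,
    ← cast_count_spinWords (isWindow_window hg)]
  exact congrArg List.sum (List.map_congr_left fun l hl =>
    XX_two_three_apply_wordProd_inv_mul (spinWords_lt l hl) hg)

theorem sum_XX_apply_of_notMem {g : Equiv.Perm (Dom 4)} (hg : g ∉ Dgroup 4) :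
    (spinWords.map fun l => (XX 4 {j | j ∈ [2, 3]}).coeff ((wordProd l)⁻¹ * g)).sum =
      2 * (XX 4 {j | j ∈ [2, 3]}).coeff g + (XX 4 {j | j ∈ [2]}).coeff g +
        (XX 4 {j | j ∈ [3]}).coeff g := by
  rw [XX_apply_of_notMem _ hg, XX_apply_of_notMem _ hg, XX_apply_of_notMem _ hg,
    List.sum_eq_zero]
  · simp
  · intro x hx
    obtain ⟨l, hl, rfl⟩ := List.mem_map.1 hx
    refine XX_apply_of_notMem _ fun h => hg ?_
    simpa using mul_mem (wordProd_mem (spinWords_lt l hl)) h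

theorem B_four : B 4 Kind.reg [4] = XX 4 {j | j ∈ [1, 2, 3]} := by
  unfold B
  congr 1
  ext s
  simp [JofC, psum]
  omega

theorem B_one_three : B 4 Kind.one [1, 3] = XX 4 {j | j ∈ [2, 3]} := by
  unfold B
  congr 1
  ext s
  have h : (∃ j, 1 ≤ j ∧ j < 2 ∧ s = psum [1, 3] j) ↔ s = 1 := by
    refine ⟨?_, fun h => ⟨1, by simp [psum, h]⟩⟩
    rintro ⟨j, h1, h2, rfl⟩
    interval_cases j
    rfl
  simp only [JofC, List.length_cons, List.length_nil, Nat.reduceAdd, h, Set.mem_sdiff, Set.mem_Iio,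
    Set.mem_union, Set.mem_singleton_iff, Set.mem_ofPred_eq, List.mem_cons, List.not_mem_nil,
    or_false]
  omega

theorem B_one_two_one : B 4 Kind.one [1, 2, 1] = XX 4 {j | j ∈ [2]} := by
  unfold B
  congr 1
  ext s
  have h : (∃ j, 1 ≤ j ∧ j < 3 ∧ s = psum [1, 2, 1] j) ↔ s = 1 ∨ s = 3 := by
    refine ⟨?_, ?_⟩
    · rintro ⟨j, h1, h2, rfl⟩
      interval_cases j <;> simp [psum]
    · rintro (rfl | rfl)
      exacts [⟨1, by simp [psum]⟩, ⟨2, by simp [psum]⟩]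
  simp [JofC, h]
  omega

theorem B_one_one_two : B 4 Kind.one [1, 1, 2] = XX 4 {j | j ∈ [3]} := by
  unfold B
  congr 1
  ext s
  have h : (∃ j, 1 ≤ j ∧ j < 3 ∧ s = psum [1, 1, 2] j) ↔ s = 1 ∨ s = 2 := by
    refine ⟨?_, ?_⟩
    · rintro ⟨j, h1, h2, rfl⟩
      interval_cases j <;> simp [psum]
    · rintro (rfl | rfl)
      exacts [⟨1, by simp [psum]⟩, ⟨2, by simp [psum]⟩]
  simp [JofC, h]
  omega

/-- Example: `B_[4] B_[1,3] = 2B_[1,3] + B_[1,2,1] + B_[1,1,2]` in `ΣD_4`. -/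
theorem example_mult_1 :
    B 4 Kind.reg [4] * B 4 Kind.one [1, 3] =
      (2 : ℚ) • B 4 Kind.one [1, 3] + B 4 Kind.one [1, 2, 1] + B 4 Kind.one [1, 1, 2] := by
  rw [B_four, B_one_three, B_one_two_one, B_one_one_two]
  ext g
  rw [XX_mul_apply, MonoidAlgebra.coeff_add, MonoidAlgebra.coeff_add, MonoidAlgebra.coeff_smul,
    Finsupp.add_apply, Finsupp.add_apply, Finsupp.smul_apply, smul_eq_mul]
  by_cases hg : g ∈ Dgroup 4
  · exact sum_XX_apply_of_mem hg
  · exact sum_XX_apply_of_notMem hg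

end DescentD
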